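/- arXiv:1607.01071 — 2 statements merged into one kernel-verified Lean document; each statement's English description precedes it below -/
import Mathlib

section
/- Let n ≥ 1 and let φ : ℝ^{2n} → ℝ be a C¹ function whose gradient is bounded, say |∇φ(y)| ≤ L for all y with η(y) ≠ 0. There is a constant c > 0, depending only on n and L, such that for every 0 < δ < 1 the following holds: if f_δ is the characteristic function of the Euclidean ball B(2δ) of radius 2δ centered at the origin in ℝ^{2n+1}, then for every (x,t) ∈ ℝ^{2n} × ℝ with ‖x‖ ≤ 1 and |t − φ(x)| ≤ δ/4 one has T_ν f_δ(x,t) ≥ c δ^{2n}. -/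
open MeasureTheory
open scoped ENNReal NNReal

noncomputable section

/-- The standard symplectic form `W(x,y) = ∑_{j=1}^n (y_{n+j} x_j − y_j x_{n+j})` on `ℝ^{2n}`. -/
def Wform (n : ℕ) (x y : Fin (2 * n) → ℝ) : ℝ :=
  ∑ j : Fin n,
    (y ⟨n + j.1, by have := j.2; omega⟩ * x ⟨j.1, by have := j.2; omega⟩ -
      y ⟨j.1, by have := j.2; omega⟩ * x ⟨n + j.1, by have := j.2; omega⟩)

/-- The density `η(w) = ∏_{j=1}^n η_j(w_j² + w_{n+j}²)`. -/
def etaProd (n : ℕ) (ηj : Fin n → ℝ → ℝ) (w : Fin (2 * n) → ℝ) : ℝ :=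
  ∏ j : Fin n,
    ηj j ((w ⟨j.1, by have := j.2; omega⟩) ^ 2 + (w ⟨n + j.1, by have := j.2; omega⟩) ^ 2)

/-- `η₀` is a smooth cutoff: `η₀ ∈ C_c^∞(ℝ)`, `0 ≤ η₀ ≤ 1`, `η₀ ≡ 1` on `[-1,1]`,
`supp η₀ ⊆ (-2,2)`. -/
def IsCutoff (η₀ : ℝ → ℝ) : Prop :=
  ContDiff ℝ (⊤ : ℕ∞) η₀ ∧ (∀ t, 0 ≤ η₀ t ∧ η₀ t ≤ 1) ∧
    (∀ t ∈ Set.Icc (-1 : ℝ) 1, η₀ t = 1) ∧ Function.support η₀ ⊆ Set.Ioo (-2 : ℝ) 2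

/-- The convolution operator
`T_ν f(x,t) = ∫_{ℝ^{2n}} f(x−w, t−φ(w)−½W(x,w)) η(w) dw` on the Heisenberg group. -/
def Tnu (n : ℕ) (φ η : (Fin (2 * n) → ℝ) → ℝ) (f : (Fin (2 * n) → ℝ) × ℝ → ℂ)
    (z : (Fin (2 * n) → ℝ) × ℝ) : ℂ :=
  ∫ w : Fin (2 * n) → ℝ, f (z.1 - w, z.2 - φ w - Wform n z.1 w / 2) * (η w : ℂ)

/-- The real-valued convolution operator `T_ν`. -/
def TnuR (n : ℕ) (φ η : (Fin (2 * n) → ℝ) → ℝ) (f : (Fin (2 * n) → ℝ) × ℝ → ℝ)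
    (z : (Fin (2 * n) → ℝ) × ℝ) : ℝ :=
  ∫ w : Fin (2 * n) → ℝ, f (z.1 - w, z.2 - φ w - Wform n z.1 w / 2) * η w

theorem Wform_self (n : ℕ) (x : Fin (2 * n) → ℝ) : Wform n x x = 0 :=
  Finset.sum_eq_zero fun _ _ => by ring

theorem Wform_sub_right (n : ℕ) (x y z : Fin (2 * n) → ℝ) :
    Wform n x (y - z) = Wform n x y - Wform n x z := by
  simp only [Wform, Pi.sub_apply, ← Finset.sum_sub_distrib]
  exact Finset.sum_congr rfl fun _ _ => by ring

theorem norm_toLp_eq_sqrt {ι : Type*} [Fintype ι] (v : ι → ℝ) :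
    ‖WithLp.toLp 2 v‖ = Real.sqrt (∑ i, v i ^ 2) := by
  simp [EuclideanSpace.norm_eq]

theorem abs_apply_le_norm_toLp {ι : Type*} [Fintype ι] (v : ι → ℝ) (i : ι) :
    |v i| ≤ ‖WithLp.toLp 2 v‖ := by
  simpa using PiLp.norm_apply_le (WithLp.toLp 2 v) i

theorem norm_toLp_le_of_abs_le {n : ℕ} (v : Fin (2 * n) → ℝ) {r : ℝ} (hr : 0 ≤ r)
    (h : ∀ i, |v i| ≤ r) : ‖WithLp.toLp 2 v‖ ≤ (2 * n + 1) * r := by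
  rw [norm_toLp_eq_sqrt]
  refine Real.sqrt_le_iff.2 ⟨by positivity, ?_⟩
  calc ∑ i, v i ^ 2 ≤ ∑ _i : Fin (2 * n), r ^ 2 :=
        Finset.sum_le_sum fun i _ => sq_le_sq' (abs_le.1 (h i)).1 (abs_le.1 (h i)).2
    _ = 2 * n * r ^ 2 := by simp
    _ ≤ ((2 * n + 1) * r) ^ 2 := by
        have hn : (0 : ℝ) ≤ n := n.cast_nonneg
        have : 0 ≤ r ^ 2 * (4 * n ^ 2 + 2 * n + 1) := by positivity
        linarith

theorem abs_Wform_le (n : ℕ) (x y : Fin (2 * n) → ℝ) :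
    |Wform n x y| ≤ 2 * n * (‖WithLp.toLp 2 x‖ * ‖WithLp.toLp 2 y‖) := by
  have hmul (i j : Fin (2 * n)) : |y i * x j| ≤ ‖WithLp.toLp 2 x‖ * ‖WithLp.toLp 2 y‖ := by
    rw [abs_mul, mul_comm]
    gcongr <;> exact abs_apply_le_norm_toLp _ _
  calc |Wform n x y|
      ≤ ∑ _j : Fin n, 2 * (‖WithLp.toLp 2 x‖ * ‖WithLp.toLp 2 y‖) := by
        refine (Finset.abs_sum_le_sum_abs _ _).trans (Finset.sum_le_sum fun j _ => ?_)
        exact (abs_sub _ _).trans ((add_le_add (hmul _ _) (hmul _ _)).trans_eq (two_mul _).symm)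
    _ = 2 * n * (‖WithLp.toLp 2 x‖ * ‖WithLp.toLp 2 y‖) := by
        simp; ring

theorem etaProd_nonneg {n : ℕ} {ηj : Fin n → ℝ → ℝ} (hη : ∀ j, IsCutoff (ηj j))
    (w : Fin (2 * n) → ℝ) : 0 ≤ etaProd n ηj w :=
  Finset.prod_nonneg fun j _ => ((hη j).2.1 _).1

theorem etaProd_le_one {n : ℕ} {ηj : Fin n → ℝ → ℝ} (hη : ∀ j, IsCutoff (ηj j))
    (w : Fin (2 * n) → ℝ) : etaProd n ηj w ≤ 1 :=
  Finset.prod_le_one (fun j _ => ((hη j).2.1 _).1) fun j _ => ((hη j).2.1 _).2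

theorem continuous_etaProd {n : ℕ} {ηj : Fin n → ℝ → ℝ} (hη : ∀ j, IsCutoff (ηj j)) :
    Continuous (etaProd n ηj) :=
  continuous_finsetProd _ fun j _ => (hη j).1.continuous.comp (by fun_prop)

theorem etaProd_eq_one {n : ℕ} {ηj : Fin n → ℝ → ℝ} (hη : ∀ j, IsCutoff (ηj j))
    {w : Fin (2 * n) → ℝ} (hw : ‖WithLp.toLp 2 w‖ ≤ 1) : etaProd n ηj w = 1 := by
  have hsum : ∑ i, w i ^ 2 ≤ 1 := by
    rw [norm_toLp_eq_sqrt] at hw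
    simpa using (Real.sqrt_le_left zero_le_one).1 hw
  refine Finset.prod_eq_one fun j _ => (hη j).2.2.1 _ ⟨neg_one_lt_zero.le.trans
    (by positivity), le_trans ?_ hsum⟩
  rw [← Finset.sum_pair (f := fun i => w i ^ 2)
    (a := (⟨j.1, by omega⟩ : Fin (2 * n))) (b := ⟨n + j.1, by omega⟩)
    (by simp only [ne_eq, Fin.mk.injEq]; have := j.2; omega)]
  exact Finset.sum_le_sum_of_subset_of_nonneg (Finset.subset_univ _) fun _ _ _ => sq_nonneg _

theorem abs_clm_apply_le {ι : Type*} [Fintype ι] [DecidableEq ι] (A : (ι → ℝ) →L[ℝ] ℝ)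
    (v : ι → ℝ) :
    |A v| ≤ Real.sqrt (∑ i, A (Pi.single i 1) ^ 2) * ‖WithLp.toLp 2 v‖ := by
  have hA : A v = ∑ i, A (Pi.single i 1) * v i := by
    conv_lhs => rw [pi_eq_sum_univ' v, map_sum]
    refine Finset.sum_congr rfl fun i _ => ?_
    rw [map_smul, smul_eq_mul, mul_comm]
  rw [norm_toLp_eq_sqrt, hA, ← Real.sqrt_mul (Finset.sum_nonneg fun _ _ => sq_nonneg _)]
  exact Real.abs_le_sqrt (Finset.sum_mul_sq_le_sq_mul_sq _ _ _)

/-- A mean value inequality on the Euclidean unit ball of `ι → ℝ`. -/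
theorem abs_sub_le_of_gradient_le {ι : Type*} [Fintype ι] [DecidableEq ι] {φ : (ι → ℝ) → ℝ}
    (hφ : Differentiable ℝ φ) {L : ℝ}
    (hL : ∀ y : ι → ℝ, ‖WithLp.toLp 2 y‖ ≤ 1 →
      Real.sqrt (∑ i, (fderiv ℝ φ y (Pi.single i 1)) ^ 2) ≤ L)
    {x w : ι → ℝ} (hx : ‖WithLp.toLp 2 x‖ ≤ 1) (hw : ‖WithLp.toLp 2 w‖ ≤ 1) :
    |φ w - φ x| ≤ L * ‖WithLp.toLp 2 (w - x)‖ := by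
  have hderiv (s : ℝ) : HasDerivAt (fun s : ℝ => φ (x + s • (w - x)))
      (fderiv ℝ φ (x + s • (w - x)) (w - x)) s := by
    refine (hφ _).hasFDerivAt.comp_hasDerivAt s ?_
    simpa using ((hasDerivAt_id s).smul_const (w - x)).const_add x
  have key := norm_image_sub_le_of_norm_deriv_le_segment_01' (C := L * ‖WithLp.toLp 2 (w - x)‖)
    (fun s _ => (hderiv s).hasDerivWithinAt) fun s hs => ?_
  · simpa using key
  refine (abs_clm_apply_le _ _).trans (mul_le_mul_of_nonneg_right (hL _ ?_) (norm_nonneg _))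
  have hball := (convex_closedBall (0 : EuclideanSpace ℝ ι) 1).add_smul_sub_mem
    (x := WithLp.toLp 2 x) (y := WithLp.toLp 2 w) (by simpa using hx) (by simpa using hw)
    ⟨hs.1, hs.2.le⟩
  simpa using hball

theorem integrable_Tnu_integrand {n : ℕ} {φ : (Fin (2 * n) → ℝ) → ℝ} (hφ : Continuous φ)
    {ηj : Fin n → ℝ → ℝ} (hη : ∀ j, IsCutoff (ηj j)) (r : ℝ) (x : Fin (2 * n) → ℝ) (t : ℝ) :
    Integrable fun w : Fin (2 * n) → ℝ =>
      (if Real.sqrt ((∑ i, ((x - w) i) ^ 2) + (t - φ w - Wform n x w / 2) ^ 2) ≤ r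
        then (1 : ℝ) else 0) * etaProd n ηj w := by
  have hW : Continuous (Wform n x) := by unfold Wform; fun_prop
  have hmeas : Measurable fun w : Fin (2 * n) → ℝ =>
      (if Real.sqrt ((∑ i, ((x - w) i) ^ 2) + (t - φ w - Wform n x w / 2) ^ 2) ≤ r
        then (1 : ℝ) else 0) * etaProd n ηj w :=
    (Measurable.ite (measurableSet_le (Continuous.measurable (by simp only [Pi.sub_apply]; fun_prop))
      measurable_const) measurable_const measurable_const).mul (continuous_etaProd hη).measurable
  refine Integrable.mono' (g := (Metric.closedBall x |r|).indicator fun _ => 1)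
    ((integrable_indicator_iff measurableSet_closedBall).2
      (integrableOn_const (measure_closedBall_lt_top.ne))) hmeas.aestronglyMeasurable
    (Filter.Eventually.of_forall fun w => ?_)
  rw [Real.norm_of_nonneg (mul_nonneg (by split_ifs <;> simp) (etaProd_nonneg hη w))]
  split_ifs with h
  · have hw : w ∈ Metric.closedBall x |r| := by
      rw [mem_closedBall_iff_norm', pi_norm_le_iff_of_nonneg (abs_nonneg r)]
      intro i
      refine le_trans ?_ (h.trans (le_abs_self r))
      refine (abs_apply_le_norm_toLp (x - w) i).trans ?_
      rw [norm_toLp_eq_sqrt]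
      exact Real.sqrt_le_sqrt (le_add_of_nonneg_right (sq_nonneg _))
    rw [Set.indicator_of_mem hw, one_mul]
    exact etaProd_le_one hη w
  · rw [zero_mul]
    exact Set.indicator_nonneg (fun _ _ => zero_le_one) w

/-- If `φ` is `C¹` with Euclidean gradient bounded by `L` on the support of `η`, then there is
`c > 0` depending only on `n` and `L` so that for `0 < δ < 1`, `f_δ = χ_{B(2δ)}`,
`‖x‖ ≤ 1` and `|t − φ(x)| ≤ δ/4`, one has `T_ν f_δ(x,t) ≥ c δ^{2n}`. -/
theorem Tnu_lower_bound (n : ℕ) (hn : 1 ≤ n) (L : ℝ) (hL : 0 ≤ L) :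
    ∃ c : ℝ, 0 < c ∧
      ∀ (φ : (Fin (2 * n) → ℝ) → ℝ) (ηj : Fin n → ℝ → ℝ),
        ContDiff ℝ 1 φ →
        (∀ j, IsCutoff (ηj j)) →
        (∀ y : Fin (2 * n) → ℝ, etaProd n ηj y ≠ 0 →
          Real.sqrt (∑ i, (fderiv ℝ φ y (Pi.single i 1)) ^ 2) ≤ L) →
        ∀ δ : ℝ, 0 < δ → δ < 1 →
        ∀ (x : Fin (2 * n) → ℝ) (t : ℝ),
          Real.sqrt (∑ i, (x i) ^ 2) ≤ 1 → |t - φ x| ≤ δ / 4 →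
          c * δ ^ (2 * n) ≤
            TnuR n φ (etaProd n ηj)
              (fun z => if Real.sqrt ((∑ i, (z.1 i) ^ 2) + z.2 ^ 2) ≤ 2 * δ then 1 else 0)
              (x, t) := by
  obtain ⟨a, ha, ha8, haL⟩ : ∃ a : ℝ, 0 < a ∧ a ≤ 1 / 8 ∧ (L + n) * (2 * a) ≤ 1 / 4 := by
    have hpos : 0 < L + n + 1 := by positivity
    refine ⟨1 / (8 * (L + n + 1)), by positivity, ?_, ?_⟩
    · exact one_div_le_one_div_of_le (by norm_num) (by linarith [n.cast_nonneg (α := ℝ)])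
    · rw [mul_one_div, mul_div_assoc', div_le_div_iff₀ (by positivity) (by norm_num)]
      linarith
  set b : ℝ := a / (2 * n + 1) with hb
  have hb0 : 0 < b := by positivity
  have hab : (2 * n + 1) * b = a := by rw [hb]; field_simp
  refine ⟨(2 * b) ^ (2 * n), by positivity, ?_⟩
  intro φ ηj hφ hη hgrad δ hδ hδ1 x t hx ht
  rw [← norm_toLp_eq_sqrt] at hx
  have haδ : a * δ ≤ 1 := by nlinarith
  set y : Fin (2 * n) → ℝ := (1 - a * δ) • x with hy
  have hynorm : ‖WithLp.toLp 2 y‖ ≤ 1 - a * δ := by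
    rw [hy, WithLp.toLp_smul, norm_smul, Real.norm_of_nonneg (by linarith)]
    exact mul_le_of_le_one_right (by linarith) hx
  have hyx : ‖WithLp.toLp 2 (y - x)‖ ≤ a * δ := by
    have : y - x = (-(a * δ)) • x := by rw [hy]; module
    rw [this, WithLp.toLp_smul, norm_smul, norm_neg, Real.norm_of_nonneg (by positivity)]
    exact mul_le_of_le_one_right (by positivity) hx
  have hlower : ∀ w ∈ Metric.closedBall y (b * δ),
      (1 : ℝ) ≤ (if Real.sqrt ((∑ i, ((x - w) i) ^ 2) + (t - φ w - Wform n x w / 2) ^ 2) ≤ 2 * δ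
        then (1 : ℝ) else 0) * etaProd n ηj w := by
    intro w hw
    have hwy : ‖WithLp.toLp 2 (w - y)‖ ≤ a * δ := by
      rw [← hab, mul_assoc]
      refine norm_toLp_le_of_abs_le _ (by positivity) fun i => ?_
      exact (norm_le_pi_norm (w - y) i).trans (mem_closedBall_iff_norm.1 hw)
    have hw1 : ‖WithLp.toLp 2 w‖ ≤ 1 := by
      have := norm_add_le (WithLp.toLp 2 (w - y)) (WithLp.toLp 2 y)
      rw [← WithLp.toLp_add, sub_add_cancel] at this
      linarith
    have hwx : ‖WithLp.toLp 2 (w - x)‖ ≤ 2 * a * δ := by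
      have := norm_add_le (WithLp.toLp 2 (w - y)) (WithLp.toLp 2 (y - x))
      rw [← WithLp.toLp_add, sub_add_sub_cancel] at this
      linarith
    have hφw : |φ w - φ x| ≤ L * (2 * a * δ) :=
      (abs_sub_le_of_gradient_le (hφ.differentiable (by norm_num))
        (fun z hz => hgrad z (by rw [etaProd_eq_one hη hz]; exact one_ne_zero)) hx hw1).trans
        (mul_le_mul_of_nonneg_left hwx hL)
    have hW : |Wform n x w| ≤ 2 * n * (2 * a * δ) := by
      have h := abs_Wform_le n x (w - x)
      rw [Wform_sub_right, Wform_self, sub_zero] at h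
      refine h.trans ?_
      exact mul_le_mul_of_nonneg_left ((mul_le_of_le_one_left (norm_nonneg _) hx).trans hwx)
        (by positivity)
    have hlast : |t - φ w - Wform n x w / 2| ≤ δ / 2 := by
      have hsmall : (L + n) * (2 * a) * δ ≤ 1 / 4 * δ := by gcongr
      rw [abs_le] at *
      constructor <;> nlinarith only [ht, hφw, hW, hsmall]
    have hfirst : ∑ i, ((x - w) i) ^ 2 ≤ δ ^ 2 := by
      have h : ‖WithLp.toLp 2 (x - w)‖ ≤ δ := by
        rw [WithLp.toLp_sub, norm_sub_rev, ← WithLp.toLp_sub]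
        nlinarith
      rw [norm_toLp_eq_sqrt] at h
      exact (Real.sqrt_le_left hδ.le).1 h
    rw [etaProd_eq_one hη hw1, mul_one, if_pos]
    refine Real.sqrt_le_iff.2 ⟨by positivity, ?_⟩
    have := sq_le_sq' (abs_le.1 hlast).1 (abs_le.1 hlast).2
    nlinarith only [this, hfirst, sq_nonneg δ]
  have hint := integrable_Tnu_integrand hφ.continuous hη (2 * δ) x t
  calc (2 * b) ^ (2 * n) * δ ^ (2 * n)
      = ∫ _w in Metric.closedBall y (b * δ), (1 : ℝ) := by
        rw [setIntegral_const, measureReal_def, Real.volume_pi_closedBall _ (by positivity),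
          ENNReal.toReal_ofReal (by positivity)]
        simp [← mul_pow, mul_assoc]
    _ ≤ ∫ w in Metric.closedBall y (b * δ),
          (if Real.sqrt ((∑ i, ((x - w) i) ^ 2) + (t - φ w - Wform n x w / 2) ^ 2) ≤ 2 * δ
            then (1 : ℝ) else 0) * etaProd n ηj w :=
        setIntegral_mono_on (integrableOn_const measure_closedBall_lt_top.ne) hint.integrableOn
          measurableSet_closedBall hlower
    _ ≤ _ := setIntegral_le_integral hint (Filter.Eventually.of_forall fun w =>
        mul_nonneg (by split_ifs <;> simp) (etaProd_nonneg hη w))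
end
end

section
/- For n ∈ ℕ (n ≥ 1) and k ∈ ℕ₀, let F_{n,k}(σ) = χ_{(0,∞)}(σ) L_k^{n−1}(σ) e^{−σ/2} σ^{n−1}. Then the Fourier transform of F_{n,k} is given by F̂_{n,k}(ξ) = ((k+n−1)!/k!) · (−1/2 + iξ)^k / (1/2 + iξ)^{k+n} for all ξ ∈ ℝ. -/
open MeasureTheory
open scoped Real

noncomputable section

/-- The generalized Laguerre polynomial `L_k^{n-1}(σ) = ∑_{i=0}^k
(k+n-1)! / ((k-i)! (n-1+i)! i!) · (−σ)^i` (for `n ≥ 1`). -/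
def laguerre (n k : ℕ) (σ : ℝ) : ℝ :=
  ∑ i ∈ Finset.range (k + 1),
    ((Nat.factorial (k + n - 1) : ℝ) /
      ((Nat.factorial (k - i)) * (Nat.factorial (n - 1 + i)) * (Nat.factorial i))) * (-σ) ^ i

/-- `F_{n,k}(σ) = χ_{(0,∞)}(σ) L_k^{n−1}(σ) e^{−σ/2} σ^{n−1}`. -/
def Fnk (n k : ℕ) (σ : ℝ) : ℝ :=
  if 0 < σ then laguerre n k σ * Real.exp (-σ / 2) * σ ^ (n - 1) else 0

/-- The Fourier transform `ĝ(ξ) = ∫_ℝ g(σ) e^{−iσξ} dσ` of a complex-valued function. -/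
def FT (g : ℝ → ℂ) (ξ : ℝ) : ℂ :=
  ∫ σ : ℝ, g σ * Complex.exp (-(σ * ξ) * Complex.I)

/-- The Fourier transform of a real-valued function. -/
def FTr (g : ℝ → ℝ) (ξ : ℝ) : ℂ :=
  ∫ σ : ℝ, (g σ : ℂ) * Complex.exp (-(σ * ξ) * Complex.I)

open Set Filter Topology in
theorem integrableOn_pow_mul_cexp_neg_mul_Ioi (m : ℕ) {z : ℂ} (hz : 0 < z.re) :
    IntegrableOn (fun t : ℝ => (t : ℂ) ^ m * Complex.exp (-z * t)) (Ioi 0) := by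
  have h := integrableOn_rpow_mul_exp_neg_mul_rpow (p := 1) (s := m) (b := z.re)
    (by have : (0 : ℝ) ≤ m := m.cast_nonneg
        linarith) one_pos hz
  refine Integrable.mono' h (Continuous.aestronglyMeasurable (by fun_prop)) ?_
  refine (ae_restrict_iff' measurableSet_Ioi).2 (ae_of_all _ fun t ht => ?_)
  have ht' : 0 < t := ht
  simp [Complex.norm_exp, abs_of_pos ht']

open Set Filter Topology in
theorem tendsto_pow_mul_cexp_neg_mul_atTop (m : ℕ) {z : ℂ} (hz : 0 < z.re) :
    Tendsto (fun t : ℝ => (t : ℂ) ^ m * Complex.exp (-z * t)) atTop (𝓝 0) := by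
  rw [tendsto_zero_iff_norm_tendsto_zero]
  refine (tendsto_rpow_mul_exp_neg_mul_atTop_nhds_zero m z.re hz).congr' ?_
  filter_upwards [eventually_gt_atTop 0] with t ht
  simp [Complex.norm_exp, abs_of_pos ht]

open Set Filter Topology in
theorem integral_pow_mul_cexp_neg_mul_Ioi (m : ℕ) {z : ℂ} (hz : 0 < z.re) :
    ∫ t : ℝ in Ioi 0, (t : ℂ) ^ m * Complex.exp (-z * t) = (m.factorial : ℂ) / z ^ (m + 1) := by
  have hz0 : z ≠ 0 := by
    rintro rfl
    simp at hz
  induction m with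
  | zero =>
    have h := integral_exp_mul_complex_Ioi (a := -z) (by simpa using hz) 0
    simpa using h
  | succ m ih =>
    have hI := (integrableOn_pow_mul_cexp_neg_mul_Ioi m hz).const_mul ((m : ℂ) + 1)
    have hJ := (integrableOn_pow_mul_cexp_neg_mul_Ioi (m + 1) hz).const_mul z
    have hd : ∀ t : ℝ, HasDerivAt (fun t : ℝ => (t : ℂ) ^ (m + 1) * Complex.exp (-z * t))
        (((m : ℂ) + 1) * ((t : ℂ) ^ m * Complex.exp (-z * t)) -
          z * ((t : ℂ) ^ (m + 1) * Complex.exp (-z * t))) t := by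
      intro t
      have h1 : HasDerivAt (fun w : ℂ => w ^ (m + 1) * Complex.exp (-z * w)) _ (t : ℂ) :=
        (hasDerivAt_pow (m + 1) (t : ℂ)).mul (((hasDerivAt_id (t : ℂ)).const_mul (-z)).cexp)
      convert! h1.comp_ofReal using 1
      simp
      ring
    have h := integral_Ioi_of_hasDerivAt_of_tendsto' (a := 0) (fun t _ => hd t) (hI.sub hJ)
      (tendsto_pow_mul_cexp_neg_mul_atTop (m + 1) hz)
    rw [integral_sub hI hJ, integral_const_mul, integral_const_mul, ih] at h
    simp only [Complex.ofReal_zero, ne_eq, Nat.add_eq_zero_iff, one_ne_zero, and_false,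
      not_false_eq_true, zero_pow, zero_mul, sub_zero] at h
    apply mul_left_cancel₀ hz0
    rw [← sub_eq_zero.1 h, Nat.factorial_succ]
    push_cast
    field_simp
    ring

theorem sum_factorial_div_pow_eq (n k : ℕ) (hn : 1 ≤ n) {z : ℂ} (hz : z ≠ 0) :
    ∑ i ∈ Finset.range (k + 1), ((k + n - 1).factorial : ℂ) /
        ((k - i).factorial * (n - 1 + i).factorial * i.factorial) * (-1) ^ i *
        (((n - 1 + i).factorial : ℂ) / z ^ (n - 1 + i + 1)) =
      ((k + n - 1).factorial : ℂ) / k.factorial * (-1 + z) ^ k / z ^ (k + n) := by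
  rw [add_pow, Finset.mul_sum, Finset.sum_div]
  refine Finset.sum_congr rfl fun i hi => ?_
  have hik : i ≤ k := Nat.lt_succ_iff.1 (Finset.mem_range.1 hi)
  have hp : z ^ (k + n) = z ^ (k - i) * z ^ (n - 1 + i + 1) := by
    rw [← pow_add]
    congr 1
    omega
  have h (j : ℕ) : (j.factorial : ℂ) ≠ 0 := Nat.cast_ne_zero.2 j.factorial_ne_zero
  rw [Nat.cast_choose ℂ hik, hp]
  have h1 := h k
  have h2 := h i
  have h3 := h (k - i)
  have h4 := h (n - 1 + i)
  field_simp

/-- **Lemma 6.** `F̂_{n,k}(ξ) = ((k+n−1)!/k!) (−1/2 + iξ)^k / (1/2 + iξ)^{k+n}`. -/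
theorem fourier_Fnk (n k : ℕ) (hn : 1 ≤ n) (ξ : ℝ) :
    FTr (Fnk n k) ξ =
      ((Nat.factorial (k + n - 1) : ℂ) / (Nat.factorial k : ℂ)) *
        (-(1 / 2) + (ξ : ℂ) * Complex.I) ^ k / ((1 / 2) + (ξ : ℂ) * Complex.I) ^ (k + n) := by
  have hre : 0 < ((1 / 2 : ℂ) + ξ * Complex.I).re := by simp
  have hz0 : (1 / 2 : ℂ) + ξ * Complex.I ≠ 0 := by
    intro h
    rw [h] at hre
    exact lt_irrefl _ hre
  set z : ℂ := 1 / 2 + ξ * Complex.I with hz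
  have hF : FTr (Fnk n k) ξ = ∫ t : ℝ in Set.Ioi 0, ∑ i ∈ Finset.range (k + 1),
      ((k + n - 1).factorial : ℂ) / ((k - i).factorial * (n - 1 + i).factorial * i.factorial) *
        (-1) ^ i * ((t : ℂ) ^ (n - 1 + i) * Complex.exp (-z * t)) := by
    rw [FTr, ← integral_indicator measurableSet_Ioi]
    congr 1 with t
    by_cases ht : 0 < t
    · have he : Complex.exp (-z * t) =
          Complex.exp (-t / 2) * Complex.exp (-(t * ξ) * Complex.I) := by
        rw [← Complex.exp_add, hz]
        ring_nf
      rw [Set.indicator_of_mem (Set.mem_Ioi.2 ht), Fnk, if_pos ht, laguerre, he]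
      push_cast
      simp only [Finset.sum_mul]
      refine Finset.sum_congr rfl fun i _ => ?_
      rw [neg_pow, pow_add]
      ring
    · rw [Set.indicator_of_notMem (by simpa using ht), Fnk, if_neg ht]
      simp
  rw [hF, integral_finsetSum _ fun i _ =>
    (integrableOn_pow_mul_cexp_neg_mul_Ioi (n - 1 + i) hre).const_mul _]
  simp only [integral_const_mul, integral_pow_mul_cexp_neg_mul_Ioi _ hre]
  rw [sum_factorial_div_pow_eq n k hn hz0]
  congr 3
  rw [hz]
  ring
end
end
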